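/- In any partitioning P of the relative complex Q = X̄ ∖ A, the vertex {5} lies in the interval of P whose top element is the facet 1457 or in the interval whose top element is the facet 4578. -/

import Mathlib

/-- The facets (maximal faces) of a collection of finite sets. -/
def facets {V : Type*} [DecidableEq V] (Φ : Finset (Finset V)) : Finset (Finset V) :=
  Φ.filter (fun F => ∀ G ∈ Φ, F ⊆ G → F = G)

/-- The simplicial complex generated by a list of facets. -/
def gen (L : List (Finset ℕ)) : Finset (Finset ℕ) :=
  L.toFinset.biUnion Finset.powerset

/-- The simplicial complex `X̄` on vertices `{0,…,9}` with fourteen facets. -/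
def Xbar : Finset (Finset ℕ) :=
  gen [{1,2,4,9},{1,2,6,9},{1,5,6,9},{1,5,8,9},{1,4,8,9},{1,4,5,8},{1,4,5,7},
       {4,5,7,8},{1,2,5,6},{0,1,2,5},{0,2,5,6},{0,1,2,3},{1,2,3,4},{1,3,4,7}]

/-- The subcomplex `A` of `X̄`, generated by five triangles. -/
def Acx : Finset (Finset ℕ) :=
  gen [{0,2,6},{0,2,3},{2,3,4},{3,4,7},{4,7,8}]

/-- The relative complex `Q = X̄ ∖ A`. -/
def Q : Finset (Finset ℕ) := Xbar \ Acx

/-- The generating facets of `X̄`. -/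
def XbarFacets : List (Finset ℕ) :=
  [{1,2,4,9},{1,2,6,9},{1,5,6,9},{1,5,8,9},{1,4,8,9},{1,4,5,8},{1,4,5,7},
   {4,5,7,8},{1,2,5,6},{0,1,2,5},{0,2,5,6},{0,1,2,3},{1,2,3,4},{1,3,4,7}]

theorem mem_gen {L : List (Finset ℕ)} {σ : Finset ℕ} : σ ∈ gen L ↔ ∃ F ∈ L, σ ⊆ F := by
  simp [gen]

theorem mem_Q {σ : Finset ℕ} : σ ∈ Q ↔ (∃ F ∈ XbarFacets, σ ⊆ F) ∧
    ¬ ∃ F ∈ ([{0,2,6},{0,2,3},{2,3,4},{3,4,7},{4,7,8}] : List (Finset ℕ)), σ ⊆ F := by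
  rw [Q, Finset.mem_sdiff, Xbar, Acx, mem_gen, mem_gen, XbarFacets]

theorem XbarFacets_subset_Q : ∀ F ∈ XbarFacets, F ∈ Q := by
  simp only [mem_Q]
  decide

/-- The facets of `Q` are among the generating facets of `X̄`. -/
theorem mem_XbarFacets_of_mem_facets {F : Finset ℕ} (hF : F ∈ facets Q) : F ∈ XbarFacets := by
  obtain ⟨hFQ, hmax⟩ := Finset.mem_filter.mp hF
  obtain ⟨G, hG, hFG⟩ := (mem_Q.mp hFQ).1
  exact hmax G (XbarFacets_subset_Q G hG) hFG ▸ hG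

/-- If `σ ∈ Q` lies in a single facet `F`, then `σ` belongs to the interval below `F`,
so the bottom of that interval is contained in `σ`. -/
theorem bottom_subset_of_unique_facet {R : Finset ℕ → Finset ℕ}
    (hpart : ∀ σ ∈ Q, ∃! F, F ∈ facets Q ∧ R F ⊆ σ ∧ σ ⊆ F) {σ F : Finset ℕ}
    (hσ : σ ∈ Q) (huniq : ∀ G ∈ XbarFacets, σ ⊆ G → G = F) : R F ⊆ σ := by
  obtain ⟨G, ⟨hG, hRG, hσG⟩, -⟩ := hpart σ hσ
  exact huniq G (mem_XbarFacets_of_mem_facets hG) hσG ▸ hRG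

/-- In any partitioning of the relative complex `Q = X̄ ∖ A` — given by a choice
`R : Finset ℕ → Finset ℕ` of bottom elements of the Boolean intervals, one for each
facet — the vertex `{5}` lies in the interval whose top element is the facet `1457`
or in the interval whose top element is the facet `4578`. -/
theorem vertex5_in_interval_of_1457_or_4578
    (R : Finset ℕ → Finset ℕ)
    (hRsub : ∀ F ∈ facets Q, R F ⊆ F)
    (hint : ∀ F ∈ facets Q, ∀ σ : Finset ℕ, R F ⊆ σ → σ ⊆ F → σ ∈ Q)
    (hpart : ∀ σ ∈ Q, ∃! F, F ∈ facets Q ∧ R F ⊆ σ ∧ σ ⊆ F) :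
    (R {1,4,5,7} ⊆ ({5} : Finset ℕ) ∧ ({5} : Finset ℕ) ⊆ {1,4,5,7}) ∨
    (R {4,5,7,8} ⊆ ({5} : Finset ℕ) ∧ ({5} : Finset ℕ) ⊆ {4,5,7,8}) := by
  have h1458 : ¬ R {1,4,5,8} ⊆ {4,5} := by
    intro h45
    -- Since `48 ∈ A`, the bottoms of `1458` and `1489` are not contained in `48`.
    have not_subset_48 : ∀ F ∈ facets Q, {4,8} ⊆ F → ¬ R F ⊆ {4,8} := fun F hF hF48 hRF =>
      absurd (hint F hF _ hRF hF48) (by rw [mem_Q]; decide)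
    have h489 : R {1,4,8,9} ⊆ {4,8,9} :=
      bottom_subset_of_unique_facet hpart (mem_Q.mpr (by decide)) (by decide)
    obtain ⟨F, ⟨hF, hRF, hF148⟩, -⟩ := hpart {1,4,8} (mem_Q.mpr (by decide))
    have hcases : ∀ F ∈ XbarFacets, {1,4,8} ⊆ F → F = {1,4,5,8} ∨ F = {1,4,8,9} := by decide
    refine not_subset_48 F hF (Finset.Subset.trans (by decide) hF148) ?_
    rcases hcases F (mem_XbarFacets_of_mem_facets hF) hF148 with rfl | rfl
    · exact (Finset.subset_inter hRF h45).trans (by decide)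
    · exact (Finset.subset_inter hRF h489).trans (by decide)
  obtain ⟨F, ⟨hF, hRF, hF45⟩, -⟩ := hpart {4,5} (mem_Q.mpr (by decide))
  have hcases : ∀ F ∈ XbarFacets, {4,5} ⊆ F →
      F = {1,4,5,8} ∨ F = {1,4,5,7} ∨ F = {4,5,7,8} := by decide
  rcases hcases F (mem_XbarFacets_of_mem_facets hF) hF45 with rfl | rfl | rfl
  · exact absurd hRF h1458
  · have h157 : R {1,4,5,7} ⊆ {1,5,7} :=
      bottom_subset_of_unique_facet hpart (mem_Q.mpr (by decide)) (by decide)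
    exact Or.inl ⟨(Finset.subset_inter hRF h157).trans (by decide), by decide⟩
  · have h578 : R {4,5,7,8} ⊆ {5,7,8} :=
      bottom_subset_of_unique_facet hpart (mem_Q.mpr (by decide)) (by decide)
    exact Or.inr ⟨(Finset.subset_inter hRF h578).trans (by decide), by decide⟩
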